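/- For every integer $n \geq 0$, $N^+(2, 19, 38n + 20) + N^+(5, 19, 38n + 22) = N^+(14, 19, 38n + 32) + N^+(7, 19, 38n + 29)$. -/

import Mathlib

/-- The Dyson rank of a partition: its largest part minus its number of parts. -/
def Nat.Partition.rank {n : ℕ} (l : n.Partition) : ℤ :=
  (l.parts.sup : ℤ) - l.parts.card

/-- `N⁺ r m n`: the number of partitions of `n` whose rank is congruent to `r` modulo `m`
and has absolute value at least `n / 2` (`0` when `n` is not a positive integer). -/
noncomputable def rankCountPlus (r m n : ℤ) : ℕ :=
  if 0 < n then
    Nat.card {l : Nat.Partition n.toNat //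
      l.rank ≡ r [ZMOD m] ∧ (n : ℚ) / 2 ≤ |(l.rank : ℚ)|}
  else 0

namespace YoungDiagram

theorem sum_rowLens (μ : YoungDiagram) : μ.rowLens.sum = μ.card := by
  have h : ∀ c ∈ μ.cells, c.1 ∈ Finset.range (μ.colLen 0) := fun c hc =>
    Finset.mem_range.2 <| mem_iff_lt_colLen.1 <|
      μ.up_left_mem le_rfl (Nat.zero_le _) (by simpa using hc)
  rw [YoungDiagram.card, Finset.card_eq_sum_card_fiberwise h, rowLens, ← Multiset.sum_coe]
  exact Finset.sum_congr (s₁ := Finset.range (μ.colLen 0)) (f := μ.rowLen) rfl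
    fun _ _ => μ.rowLen_eq_card

theorem sup_rowLens (μ : YoungDiagram) : (μ.rowLens : Multiset ℕ).sup = μ.rowLen 0 := by
  apply le_antisymm
  · refine Multiset.sup_le.2 fun b hb => ?_
    obtain ⟨i, -, rfl⟩ := List.mem_map.1 (Multiset.mem_coe.1 hb)
    exact μ.rowLen_anti 0 i (Nat.zero_le _)
  · rcases Nat.eq_zero_or_pos (μ.rowLen 0) with h | h
    · rw [h]
      exact Nat.zero_le _
    · refine Multiset.le_sup (Multiset.mem_coe.2 (List.mem_map.2 ⟨0, ?_, rfl⟩))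
      rwa [List.mem_range, ← mem_iff_lt_colLen, mem_iff_lt_rowLen]

/-- The partition whose parts are the row lengths of a Young diagram. -/
def toPartition {n : ℕ} (μ : {μ : YoungDiagram // μ.card = n}) : n.Partition where
  parts := μ.1.rowLens
  parts_pos h := μ.1.pos_of_mem_rowLens _ h
  parts_sum := by simpa using μ.1.sum_rowLens.trans μ.2

theorem rank_toPartition {n : ℕ} (μ : {μ : YoungDiagram // μ.card = n}) :
    (toPartition μ).rank = (μ.1.rowLen 0 : ℤ) - μ.1.colLen 0 := by
  rw [Nat.Partition.rank, toPartition, sup_rowLens, Multiset.coe_card, length_rowLens]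

theorem toPartition_bijective (n : ℕ) : Function.Bijective (toPartition (n := n)) := by
  constructor
  · intro μ ν h
    have hp : μ.1.rowLens.Perm ν.1.rowLens :=
      Multiset.coe_eq_coe.1 (congrArg Nat.Partition.parts h)
    have hl := hp.eq_of_sortedGE μ.1.rowLens_sorted ν.1.rowLens_sorted
    exact Subtype.ext (equivListRowLens.injective (Subtype.ext hl))
  · intro l
    have hs : (l.parts.sort (· ≥ ·)).SortedGE := (Multiset.pairwise_sort _ _).sortedGE
    have hpos : ∀ x ∈ l.parts.sort (· ≥ ·), 0 < x := fun x hx =>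
      l.parts_pos ((Multiset.mem_sort _).1 hx)
    have hr := rowLens_ofRowLens_eq_self (hw := hs) hpos
    refine ⟨⟨ofRowLens _ hs, ?_⟩, ?_⟩
    · rw [← sum_rowLens, hr, ← Multiset.sum_coe, Multiset.sort_eq, l.parts_sum]
    · apply Nat.Partition.ext
      simp [toPartition, hr]

end YoungDiagram

namespace Nat.Partition

theorem card_rank_neg (n : ℕ) (s : ℤ) :
    Nat.card {l : n.Partition // l.rank = -s} = Nat.card {l : n.Partition // l.rank = s} := by
  let e := Equiv.ofBijective _ (YoungDiagram.toPartition_bijective n)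
  let t : {μ : YoungDiagram // μ.card = n} ≃ {μ : YoungDiagram // μ.card = n} :=
    YoungDiagram.transposeOrderIso.toEquiv.subtypeEquiv fun μ => by
      simp [YoungDiagram.card, YoungDiagram.transpose]
  refine Nat.card_congr (((e.symm.trans t).trans e).subtypeEquiv fun l => ?_)
  obtain ⟨μ, rfl⟩ := e.surjective l
  have h : (t μ).1 = μ.1.transpose := rfl
  simp only [Equiv.trans_apply, Equiv.symm_apply_apply]
  simp only [e, Equiv.ofBijective_apply, YoungDiagram.rank_toPartition, h,
    YoungDiagram.rowLen_transpose, YoungDiagram.colLen_transpose]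
  omega

/-- The number of multisets of positive integers whose sum and cardinality add up to `j`. -/
noncomputable def sumAddCardCount (j : ℕ) : ℕ :=
  Nat.card {μ : Multiset ℕ // (∀ x ∈ μ, 0 < x) ∧ μ.sum + μ.card = j}

theorem sup_mem_parts {n : ℕ} (hn : 0 < n) (l : n.Partition) : l.parts.sup ∈ l.parts := by
  have h : l.parts ≠ 0 := by
    rintro h
    have := l.parts_sum
    simp [h] at this
    omega
  obtain ⟨x, hx, hmax⟩ := l.parts.toFinset.exists_max_image id (by simpa using h)
  simp only [Multiset.mem_toFinset, id] at hx hmax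
  rwa [le_antisymm (Multiset.sup_le.2 hmax) (Multiset.le_sup hx)]

theorem card_le_sum {μ : Multiset ℕ} (h : ∀ x ∈ μ, 0 < x) : μ.card ≤ μ.sum := by
  simpa using Multiset.card_nsmul_le_sum (a := 1) h

theorem abs_rank_lt {n : ℕ} (hn : 0 < n) (l : n.Partition) : |l.rank| < n := by
  have h := sup_mem_parts hn l
  have h1 := l.parts_pos h
  have h2 := Multiset.le_sum_of_mem h
  have h3 := Multiset.card_pos_iff_exists_mem.2 ⟨_, h⟩
  have h4 := card_le_sum fun x hx => l.parts_pos (i := x) hx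
  rw [l.parts_sum] at h2 h4
  rw [rank, abs_lt]
  omega

/-- Removing the largest part of a partition of large rank is reversible. -/
theorem card_rank_eq {n j : ℕ} (h : 2 * (j + 1) ≤ n) :
    Nat.card {l : n.Partition // l.rank = n - 1 - j} = sumAddCardCount j := by
  have hsup : ∀ μ : Multiset ℕ, μ.sum + μ.card = j →
      ((n - j + μ.card) ::ₘ μ).sup = n - j + μ.card := fun μ hμ => by
    rw [Multiset.sup_cons]
    refine sup_eq_left.2 (Multiset.sup_le.2 fun x hx => ?_)
    have := Multiset.le_sum_of_mem hx
    omega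
  have hcons : ∀ l : n.Partition, l.parts.sup ::ₘ l.parts.erase l.parts.sup = l.parts := fun l =>
    Multiset.cons_erase (sup_mem_parts (by omega) l)
  have hsum : ∀ l : n.Partition, l.parts.sup + (l.parts.erase l.parts.sup).sum = n := fun l => by
    rw [← Multiset.sum_cons, hcons, l.parts_sum]
  have hcard : ∀ l : n.Partition, (l.parts.erase l.parts.sup).card + 1 = l.parts.card := fun l => by
    rw [← Multiset.card_cons l.parts.sup, hcons]
  refine Nat.card_congr
    { toFun := fun l => ⟨l.1.parts.erase l.1.parts.sup,
        fun x hx => l.1.parts_pos (Multiset.mem_of_mem_erase hx), ?_⟩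
      invFun := fun μ => ⟨⟨(n - j + μ.1.card) ::ₘ μ.1, ?_, ?_⟩, ?_⟩
      left_inv := fun l => ?_
      right_inv := fun μ => ?_ }
  · have h1 := hsum l.1
    have h2 := hcard l.1
    have h3 := l.2
    rw [rank] at h3
    omega
  · intro i hi
    rcases Multiset.mem_cons.1 hi with rfl | hi
    · omega
    · exact μ.2.1 i hi
  · have := μ.2.2
    rw [Multiset.sum_cons]
    omega
  · rw [rank, hsup _ μ.2.2, Multiset.card_cons]
    push_cast
    omega
  · apply Subtype.ext
    apply Nat.Partition.ext
    have h1 : n - j + (l.1.parts.erase l.1.parts.sup).card = l.1.parts.sup := by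
      have h2 := hcard l.1
      have h3 := l.2
      rw [rank] at h3
      omega
    simp only [h1]
    exact hcons l.1
  · apply Subtype.ext
    simp only [hsup _ μ.2.2, Multiset.erase_cons_head]

/-- The sum of `sumAddCardCount j` over `j < M` with `j ≡ c` modulo `m`. -/
noncomputable def residueSum (m c : ℤ) (M : ℕ) : ℕ :=
  ∑ j ∈ Finset.range M, if (j : ℤ) ≡ c [ZMOD m] then sumAddCardCount j else 0

theorem residueSum_add {m c : ℤ} {M : ℕ} (d : ℕ)
    (h : ∀ i < d, ¬ ((M + i : ℕ) : ℤ) ≡ c [ZMOD m]) :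
    residueSum m c (M + d) = residueSum m c M := by
  rw [residueSum, Finset.sum_range_add, ← residueSum, Nat.add_eq_left]
  exact Finset.sum_eq_zero fun i hi => if_neg (h i (Finset.mem_range.1 hi))

theorem residueSum_congr {m c d : ℤ} (h : c ≡ d [ZMOD m]) (M : ℕ) :
    residueSum m c M = residueSum m d M := by
  refine Finset.sum_congr rfl fun j _ => ?_
  simp only [show (j : ℤ) ≡ c [ZMOD m] ↔ (j : ℤ) ≡ d [ZMOD m] from
    ⟨fun hj => hj.trans h, fun hj => hj.trans h.symm⟩]

theorem card_modEq_and_abs_rank_eq {r m : ℤ} {n j : ℕ} (h : 2 * (j + 1) ≤ n) :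
    Nat.card {l : n.Partition // l.rank ≡ r [ZMOD m] ∧ |l.rank| = n - 1 - j} =
      (if (j : ℤ) ≡ n - 1 - r [ZMOD m] then sumAddCardCount j else 0) +
      (if (j : ℤ) ≡ n - 1 + r [ZMOD m] then sumAddCardCount j else 0) := by
  have key : ∀ s : ℤ, Nat.card {l : n.Partition // l.rank = s} = sumAddCardCount j →
      (Finset.univ.filter fun l : n.Partition => l.rank ≡ r [ZMOD m] ∧ l.rank = s).card =
        if s ≡ r [ZMOD m] then sumAddCardCount j else 0 := fun s hs => by
    split_ifs with hr
    · rw [← hs, Nat.card_eq_fintype_card, Fintype.card_subtype]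
      congr 1
      ext l
      simp only [Finset.mem_filter, Finset.mem_univ, true_and]
      exact ⟨And.right, fun h => ⟨h ▸ hr, h⟩⟩
    · rw [Finset.card_eq_zero, Finset.filter_eq_empty_iff]
      rintro l - ⟨h1, h2⟩
      exact hr (h2 ▸ h1)
  have hp : ((n : ℤ) - 1 - j ≡ r [ZMOD m]) ↔ (j : ℤ) ≡ n - 1 - r [ZMOD m] := by
    rw [Int.modEq_iff_dvd, Int.modEq_iff_dvd, ← dvd_neg]
    ring_nf
  have hq : (-((n : ℤ) - 1 - j) ≡ r [ZMOD m]) ↔ (j : ℤ) ≡ n - 1 + r [ZMOD m] := by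
    rw [Int.modEq_iff_dvd, Int.modEq_iff_dvd]
    ring_nf
  have hc := card_rank_eq h
  simp only [← hp, ← hq]
  rw [← key _ hc, ← key _ ((card_rank_neg n _).trans hc), ← Finset.card_union_of_disjoint,
    Nat.card_eq_fintype_card, Fintype.card_subtype]
  · congr 1
    ext l
    simp only [Finset.mem_filter, Finset.mem_univ, true_and, Finset.mem_union, ← and_or_left]
    rw [abs_eq (by omega)]
  · rw [Finset.disjoint_filter]
    rintro l - ⟨-, h1⟩ ⟨-, h2⟩
    omega

end Nat.Partition

open Nat.Partition in
theorem rankCountPlus_eq_residueSum (r m : ℤ) {n : ℕ} (hn : 0 < n) :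
    rankCountPlus r m n =
      residueSum m (n - 1 - r) (n / 2) + residueSum m (n - 1 + r) (n / 2) := by
  have habs : ∀ l : n.Partition, ((n : ℤ) : ℚ) / 2 ≤ |(l.rank : ℚ)| ↔ (n : ℤ) ≤ 2 * |l.rank| :=
    fun l => by
      rw [div_le_iff₀ two_pos, mul_comm]
      exact_mod_cast Iff.rfl
  rw [rankCountPlus, if_pos (by exact_mod_cast hn), residueSum, residueSum,
    ← Finset.sum_add_distrib]
  simp only [Int.toNat_natCast, habs]
  rw [Nat.card_eq_fintype_card, Fintype.card_subtype,
    Finset.card_eq_sum_card_fiberwise (f := fun l => ((n : ℤ) - 1 - |l.rank|).toNat)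
      (t := Finset.range (n / 2))]
  · refine Finset.sum_congr rfl fun j hj => ?_
    rw [Finset.mem_range] at hj
    rw [← card_modEq_and_abs_rank_eq (by omega), Nat.card_eq_fintype_card, Fintype.card_subtype,
      Finset.filter_filter]
    congr 1
    ext l
    have := abs_rank_lt hn l
    simp only [Finset.mem_filter, Finset.mem_univ, true_and, and_assoc]
    refine and_congr_right fun _ => ?_
    omega
  · intro l hl
    have h1 := abs_rank_lt hn l
    have h2 := (Finset.mem_filter.1 hl).2.2
    simp only [Finset.coe_range, Set.mem_Iio]
    omega

open Nat.Partition in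
theorem rankCountPlus_ex19 (n : ℤ) (hn : 0 ≤ n) :
    rankCountPlus 2 19 (38 * n + 20) + rankCountPlus 5 19 (38 * n + 22)
      = rankCountPlus 14 19 (38 * n + 32) + rankCountPlus 7 19 (38 * n + 29) := by
  lift n to ℕ using hn
  have key : ∀ (r c d : ℤ) (a b : ℕ), 0 < a → a / 2 = b → a - 1 - r ≡ c [ZMOD 19] →
      a - 1 + r ≡ d [ZMOD 19] → rankCountPlus r 19 (38 * n + a) =
        residueSum 19 c (19 * n + b) + residueSum 19 d (19 * n + b) := by
    intro r c d a b ha hb hc hd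
    have h := rankCountPlus_eq_residueSum r 19 (n := 38 * n + a) (by omega)
    rw [show (38 * n + a) / 2 = 19 * n + b by omega] at h
    push_cast at h
    rw [h]
    congr 1 <;> apply residueSum_congr <;> rw [Int.ModEq] at * <;> omega
  have h₁ := key 2 17 2 20 10 (by decide) rfl rfl rfl
  have h₂ := key 5 16 7 22 11 (by decide) rfl rfl rfl
  have h₃ := key 14 17 7 32 16 (by decide) rfl rfl rfl
  have h₄ := key 7 2 16 29 14 (by decide) rfl rfl rfl
  have e₁ : residueSum 19 17 (19 * n + 16) = residueSum 19 17 (19 * n + 10) :=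
    residueSum_add 6 fun i hi => by rw [Int.ModEq]; omega
  have e₂ : residueSum 19 2 (19 * n + 14) = residueSum 19 2 (19 * n + 10) :=
    residueSum_add 4 fun i hi => by rw [Int.ModEq]; omega
  have e₃ : residueSum 19 16 (19 * n + 14) = residueSum 19 16 (19 * n + 11) :=
    residueSum_add 3 fun i hi => by rw [Int.ModEq]; omega
  have e₄ : residueSum 19 7 (19 * n + 16) = residueSum 19 7 (19 * n + 11) :=
    residueSum_add 5 fun i hi => by rw [Int.ModEq]; omega
  push_cast at h₁ h₂ h₃ h₄
  omega
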